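/- Let n ≥ 1 and let V : ℝ × ℝⁿ → ℝ be C^∞ and sub-quadratic with exponent ρ ∈ (0,1). Let K ⊂ ℝⁿ be compact, a ≥ 1, and fix t ∈ ℝ. Then there exists C > 0 such that for all λ ≥ 1, all x ∈ K and all ξ ∈ ℝⁿ with a^{−1} ≤ |ξ| ≤ a: | x(0; t, x, λξ) − (x − λ t ξ) | ≤ C λ^{ρ−1} and | ξ(0; t, x, λξ) − λ ξ | ≤ C λ^{ρ−1}. -/

import Mathlib

open MeasureTheory Complex
open scoped InnerProductSpace BigOperators

noncomputable section

/-- `ℝⁿ` as a Euclidean space. -/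
abbrev Euc (n : ℕ) := EuclideanSpace ℝ (Fin n)

variable {n : ℕ}

/-- Wave packet transform `W_φ f (x, ξ) = ∫ conj (φ (y - x)) f y e^{-i y·ξ} dy`. -/
def WPT (φ f : Euc n → ℂ) (x ξ : Euc n) : ℂ :=
  ∫ y, (starRingEnd ℂ) (φ (y - x)) * f y * Complex.exp (-Complex.I * ((⟪y, ξ⟫_ℝ : ℝ) : ℂ))

/-- Fourier transform `f̂(ξ) = ∫ e^{-i y·ξ} f y dy`. -/
def FT (f : Euc n → ℂ) (ξ : Euc n) : ℂ :=
  ∫ y, Complex.exp (-Complex.I * ((⟪y, ξ⟫_ℝ : ℝ) : ℂ)) * f y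

/-- Free Schrödinger evolution `U₀(t) f (x) = (2π)^{-n} ∫ e^{i(x·ξ - t|ξ|²/2)} f̂(ξ) dξ`. -/
def U0 (t : ℝ) (f : Euc n → ℂ) (x : Euc n) : ℂ :=
  (((2 * Real.pi) ^ n)⁻¹ : ℝ) •
    ∫ ξ, Complex.exp (Complex.I * ((⟪x, ξ⟫_ℝ - t * ‖ξ‖ ^ 2 / 2 : ℝ) : ℂ)) * FT f ξ

/-- Dilation `(φ)_λ(x) = λ^{n b / 2} φ (λ^b x)` (with `λ^b` a real power). -/
def dilate (b lam : ℝ) (φ : Euc n → ℂ) : Euc n → ℂ :=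
  fun x => ((lam ^ ((n : ℝ) * b / 2) : ℝ) : ℂ) * φ ((lam ^ b : ℝ) • x)

/-- `V` is smooth and sub-quadratic with exponent `ρ`:
`|∂_x^α V(t,x)| ≤ C_α (1+|x|)^{ρ-|α|}` for all multi-indices `α`. -/
def SubQuadratic (ρ : ℝ) (V : ℝ × Euc n → ℝ) : Prop :=
  ContDiff ℝ (⊤ : ℕ∞) V ∧
    ∀ k : ℕ, ∃ C : ℝ, 0 < C ∧ ∀ (t : ℝ) (x : Euc n),
      ‖iteratedFDeriv ℝ k (fun z => V (t, z)) x‖ ≤ C * (1 + ‖x‖) ^ (ρ - (k : ℝ))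

/-- Gradient of `V` in the `x` variable. -/
def gradV (V : ℝ × Euc n → ℝ) (t : ℝ) (x : Euc n) : Euc n :=
  gradient (fun z => V (t, z)) x

/-- `(X, Ξ)` solves the Hamilton equations `ẋ = ξ`, `ξ̇ = -∇ₓ V`. -/
def IsHamiltonSol (V : ℝ × Euc n → ℝ) (X Ξ : ℝ → Euc n) : Prop :=
  (∀ s, HasDerivAt X (Ξ s) s) ∧ (∀ s, HasDerivAt Ξ (-gradV V s (X s)) s)

/-- `Γ` is a conic neighborhood of `ξ₀`. -/
def IsConicNbhd (Γ : Set (Euc n)) (ξ₀ : Euc n) : Prop :=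
  Γ ∈ nhds ξ₀ ∧ ∀ ξ ∈ Γ, ∀ c : ℝ, 0 < c → c • ξ ∈ Γ

/-- `(x₀, ξ₀)` is not in the wave front set of the (locally integrable) function `f`. -/
def NotInWF (f : Euc n → ℂ) (x₀ ξ₀ : Euc n) : Prop :=
  ∃ χ : Euc n → ℝ, ContDiff ℝ (⊤ : ℕ∞) χ ∧ HasCompactSupport χ ∧ χ x₀ ≠ 0 ∧
    ∃ Γ₀ : Set (Euc n), IsConicNbhd Γ₀ ξ₀ ∧
      ∀ N : ℕ, ∃ C : ℝ, 0 < C ∧ ∀ ξ ∈ Γ₀,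
        ‖∫ y, (χ y : ℂ) * f y * Complex.exp (-Complex.I * ((⟪y, ξ⟫_ℝ : ℝ) : ℂ))‖ ≤
          C * (1 + ‖ξ‖) ^ (-(N : ℝ))

/-- `∂_t Φ` for `Φ : ℝ × ℝⁿ → ℂ`. -/
def tDerivP (Φ : ℝ × Euc n → ℂ) (p : ℝ × Euc n) : ℂ :=
  fderiv ℝ Φ p ((1 : ℝ), (0 : Euc n))

/-- `∂_{x_j} Φ` for `Φ : ℝ × ℝⁿ → ℂ`. -/
def xPartialP (j : Fin n) (Φ : ℝ × Euc n → ℂ) (p : ℝ × Euc n) : ℂ :=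
  fderiv ℝ (fun z => Φ (p.1, z)) p.2 (EuclideanSpace.single j 1)

/-- Laplacian in the `x` variable of `Φ : ℝ × ℝⁿ → ℂ`. -/
def xLaplacianP (Φ : ℝ × Euc n → ℂ) (p : ℝ × Euc n) : ℂ :=
  ∑ j : Fin n, xPartialP j (fun q => xPartialP j Φ q) p

/-- `u` is a distributional solution of `i ∂_t u + (1/2) Δ u - V u = 0`:
`∬ u (−i∂_tΦ + (1/2)ΔΦ − VΦ) dx dt = 0` for every test function `Φ`. -/
def IsDistSol (V : ℝ × Euc n → ℝ) (u : ℝ → Euc n → ℂ) : Prop :=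
  ∀ Φ : ℝ × Euc n → ℂ, ContDiff ℝ (⊤ : ℕ∞) Φ → HasCompactSupport Φ →
    (∫ p : ℝ × Euc n, u p.1 p.2 *
        (-Complex.I * tDerivP Φ p + (1 / 2 : ℂ) * xLaplacianP Φ p - ((V p : ℝ) : ℂ) * Φ p)) = 0

/-- `∂_{y_j} g` for `g : ℝⁿ → ℂ`. -/
def partialD (j : Fin n) (g : Euc n → ℂ) : Euc n → ℂ :=
  fun y => fderiv ℝ g y (EuclideanSpace.single j 1)

/-- Laplacian of `g : ℝⁿ → ℂ`. -/
def lapl (g : Euc n → ℂ) : Euc n → ℂ :=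
  fun y => ∑ j : Fin n, partialD j (partialD j g) y

/-- Multi-index derivative `∂^α g`. -/
def multiPartial (α : Fin n → ℕ) (g : Euc n → ℂ) : Euc n → ℂ :=
  ((List.ofFn fun j : Fin n => (partialD j)^[α j]).foldr (· ∘ ·) id) g


/-- The gradient of a sub-quadratic potential decays like `(1 + ‖x‖) ^ (ρ - 1)`, uniformly in
time. -/
lemma SubQuadratic.exists_norm_gradV_le {ρ : ℝ} {V : ℝ × Euc n → ℝ} (hV : SubQuadratic ρ V) :
    ∃ C : ℝ, 0 < C ∧ ∀ (s : ℝ) (x : Euc n), ‖gradV V s x‖ ≤ C * (1 + ‖x‖) ^ (ρ - 1) := by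
  obtain ⟨C, hC, h⟩ := hV.2 1
  refine ⟨C, hC, fun s x => ?_⟩
  have h1 := h s x
  rw [norm_iteratedFDeriv_one, Nat.cast_one] at h1
  simpa only [gradV, gradient, LinearIsometryEquiv.norm_map] using h1

/-- Reparametrisation of a curve along the segment from `t` to `0`. -/
lemma hasDerivAt_comp_sub_mul {E : Type*} [NormedAddCommGroup E] [NormedSpace ℝ E]
    {f : ℝ → E} {f' : E} {t r : ℝ} (hf : HasDerivAt f f' (t - r * t)) :
    HasDerivAt (fun r => f (t - r * t)) ((-t) • f') r := by
  have h : HasDerivAt (fun r : ℝ => t - r * t) (-t) r := by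
    simpa using ((hasDerivAt_id r).mul_const t).const_sub t
  exact hf.scomp r h

/-- A bound on the force along the segment from `t` to `0` controls the change of momentum. -/
lemma IsHamiltonSol.norm_momentum_sub_le {V : ℝ × Euc n → ℝ} {X Ξ : ℝ → Euc n}
    (h : IsHamiltonSol V X Ξ) {t : ℝ} {B B' : ℝ → ℝ} (hB0 : 0 ≤ B 0)
    (hB : ∀ r ∈ Set.Icc (0 : ℝ) 1, HasDerivAt B (B' r) r)
    (bound : ∀ r ∈ Set.Icc (0 : ℝ) 1, |t| * ‖gradV V (t - r * t) (X (t - r * t))‖ ≤ B' r) :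
    ∀ r ∈ Set.Icc (0 : ℝ) 1, ‖Ξ (t - r * t) - Ξ t‖ ≤ B r := by
  have hd : ∀ r, HasDerivAt (fun r => Ξ (t - r * t) - Ξ t)
      ((-t) • -gradV V (t - r * t) (X (t - r * t))) r := fun r =>
    (hasDerivAt_comp_sub_mul (h.2 (t - r * t))).sub_const _
  refine image_norm_le_of_norm_deriv_right_le_deriv_boundary'
    (fun r _ => (hd r).continuousAt.continuousWithinAt) (fun r _ => (hd r).hasDerivWithinAt)
    (by simpa using hB0) (fun r hr => (hB r hr).continuousAt.continuousWithinAt)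
    (fun r hr => (hB r (Set.Ico_subset_Icc_self hr)).hasDerivWithinAt) fun r hr => ?_
  simpa [norm_smul] using bound r (Set.Ico_subset_Icc_self hr)

/-- If the momentum stays `D`-close to `η` between `t` and `0`, the position stays
`|t| * D`-close to the free trajectory with momentum `η`. -/
lemma IsHamiltonSol.norm_position_sub_le {V : ℝ × Euc n → ℝ} {X Ξ : ℝ → Euc n}
    (h : IsHamiltonSol V X Ξ) {t D : ℝ} {η : Euc n} (hD : 0 ≤ D)
    (bound : ∀ r ∈ Set.Icc (0 : ℝ) 1, ‖Ξ (t - r * t) - η‖ ≤ D) :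
    ∀ r ∈ Set.Icc (0 : ℝ) 1, ‖X (t - r * t) - (X t - (r * t) • η)‖ ≤ |t| * D := by
  have hd : ∀ r, HasDerivAt (fun r => X (t - r * t) - (X t - (r * t) • η))
      ((-t) • (Ξ (t - r * t) - η)) r := fun r => by
    have h1 : HasDerivAt (fun r : ℝ => X t - (r * t) • η) (-(t • η)) r := by
      simpa using (((hasDerivAt_id r).mul_const t).smul_const η).const_sub (X t)
    refine ((hasDerivAt_comp_sub_mul (h.1 (t - r * t))).sub h1).congr_deriv ?_
    module
  intro r hr
  have h2 := norm_image_sub_le_of_norm_deriv_le_segment'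
    (fun r _ => (hd r).hasDerivWithinAt) (C := |t| * D) (fun s hs => by
      rw [norm_smul, norm_neg, Real.norm_eq_abs]
      exact mul_le_mul_of_nonneg_left (bound s (Set.Ico_subset_Icc_self hs)) (abs_nonneg t)) r hr
  simp only [zero_mul, sub_zero, zero_smul, sub_self] at h2
  exact h2.trans (mul_le_of_le_one_right (by positivity) hr.2)

/-- A trajectory that stays `M`-close to the line with velocity `lam • ξ` escapes linearly. -/
lemma one_add_mul_le_of_norm_sub_le {E : Type*} [NormedAddCommGroup E] [NormedSpace ℝ E]
    {y x ξ : E} {a c R M : ℝ} (ha : 1 ≤ a) (hξ : a⁻¹ ≤ ‖ξ‖) (hx : ‖x‖ ≤ R)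
    (h : ‖y - (x - c • ξ)‖ ≤ M) :
    1 + |c| ≤ a * (1 + (R + M)) * (1 + ‖y‖) := by
  have h0 : 0 < a := by linarith
  have h1 : |c| * ‖ξ‖ ≤ ‖y‖ + (R + M) := by
    rw [← Real.norm_eq_abs, ← norm_smul]
    calc ‖c • ξ‖ = ‖(y - (x - c • ξ)) - y + x‖ := by congr 1; abel
      _ ≤ ‖y - (x - c • ξ)‖ + ‖y‖ + ‖x‖ :=
        (norm_add_le _ _).trans (by gcongr; exact norm_sub_le _ _)
      _ ≤ ‖y‖ + (R + M) := by linarith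
  have h2 : |c| ≤ a * (‖y‖ + (R + M)) := by
    have h3 : |c| * a⁻¹ ≤ ‖y‖ + (R + M) :=
      (mul_le_mul_of_nonneg_left hξ (abs_nonneg c)).trans h1
    rwa [← div_eq_mul_inv, div_le_iff₀' h0] at h3
  have h4 : 0 ≤ a * ((R + M) * ‖y‖) := by
    have := (norm_nonneg x).trans hx
    have := (norm_nonneg _).trans h
    positivity
  linarith

/-- For `0 < ρ < 1`, the Hamiltonian flow with data `x(t) = x`,
`ẋ(t) = λξ` is a perturbation of the free flow:
`|x(0) - (x - λtξ)| ≤ C λ^{ρ-1}` and `|ξ(0) - λξ| ≤ C λ^{ρ-1}`. -/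
theorem hamilton_flow_free_approximation (hn : 1 ≤ n) (V : ℝ × Euc n → ℝ) (ρ : ℝ)
    (hρ0 : 0 < ρ) (hρ1 : ρ < 1) (hV : SubQuadratic ρ V)
    (K : Set (Euc n)) (hK : IsCompact K) (a : ℝ) (ha : 1 ≤ a) (t : ℝ) :
    ∃ C : ℝ, 0 < C ∧
      ∀ lam : ℝ, 1 ≤ lam → ∀ x ∈ K, ∀ ξ : Euc n, a⁻¹ ≤ ‖ξ‖ → ‖ξ‖ ≤ a →
        ∀ X Ξ : ℝ → Euc n, IsHamiltonSol V X Ξ → X t = x → Ξ t = lam • ξ →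
          ‖X 0 - (x - (lam * t) • ξ)‖ ≤ C * lam ^ (ρ - 1) ∧
            ‖Ξ 0 - lam • ξ‖ ≤ C * lam ^ (ρ - 1) := by
  obtain ⟨C, hC, hgrad⟩ := hV.exists_norm_gradV_le
  obtain ⟨R, hR⟩ := hK.isBounded.exists_norm_le
  set A := a * (1 + (max R 0 + |t| * (|t| * C))) with hA
  have hA0 : 0 < A := by
    have := le_max_right R 0
    positivity
  set D := C * A ^ (1 - ρ) with hD
  have hD0 : 0 < D := by positivity
  set F := D / ρ * (1 + |t|) ^ ρ with hF
  have hF0 : 0 < F := by positivity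
  refine ⟨(1 + |t|) * F, by positivity, ?_⟩
  intro lam hlam x hx ξ hξ _ X Ξ hsol hXt hΞt
  have hlam0 : 0 < lam := by linarith
  have hcrude : ∀ r ∈ Set.Icc (0 : ℝ) 1, ‖Ξ (t - r * t) - lam • ξ‖ ≤ |t| * C := by
    intro r hr
    have h1 := hsol.norm_momentum_sub_le (t := t) (B := fun r => |t| * C * r)
      (B' := fun _ => |t| * C) (by simp)
      (fun r _ => by simpa using (hasDerivAt_id r).const_mul (|t| * C))
      (fun r _ => mul_le_mul_of_nonneg_left ((hgrad _ _).trans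
        (mul_le_of_le_one_right hC.le (Real.rpow_le_one_of_one_le_of_nonpos
          (by linarith [norm_nonneg (X (t - r * t))]) (by linarith)))) (abs_nonneg t)) r hr
    rw [hΞt] at h1
    exact h1.trans (mul_le_of_le_one_right (by positivity) hr.2)
  have hescape : ∀ r ∈ Set.Icc (0 : ℝ) 1,
      1 + lam * |t| * r ≤ A * (1 + ‖X (t - r * t)‖) := by
    intro r hr
    have h1 := hsol.norm_position_sub_le (by positivity) hcrude r hr
    rw [hXt, smul_smul] at h1
    have h2 := one_add_mul_le_of_norm_sub_le ha hξ ((hR x hx).trans (le_max_left R 0)) h1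
    rw [abs_mul, abs_mul, abs_of_nonneg hr.1, abs_of_pos hlam0] at h2
    linarith
  have hforce : ∀ r ∈ Set.Icc (0 : ℝ) 1,
      ‖gradV V (t - r * t) (X (t - r * t))‖ ≤ D * (1 + lam * |t| * r) ^ (ρ - 1) := by
    intro r hr
    have hr0 := hr.1
    have h1 : (1 + ‖X (t - r * t)‖) ^ (ρ - 1) ≤ ((1 + lam * |t| * r) / A) ^ (ρ - 1) :=
      Real.rpow_le_rpow_of_nonpos (by positivity)
        ((div_le_iff₀' hA0).2 (hescape r hr)) (by linarith)
    rw [Real.div_rpow (by positivity) hA0.le, div_eq_mul_inv, ← Real.rpow_neg hA0.le,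
      neg_sub] at h1
    calc _ ≤ C * (1 + ‖X (t - r * t)‖) ^ (ρ - 1) := hgrad _ _
      _ ≤ C * ((1 + lam * |t| * r) ^ (ρ - 1) * A ^ (1 - ρ)) := by gcongr
      _ = D * (1 + lam * |t| * r) ^ (ρ - 1) := by rw [hD]; ring
  have hsharp : ∀ r ∈ Set.Icc (0 : ℝ) 1, ‖Ξ (t - r * t) - lam • ξ‖ ≤ F * lam ^ (ρ - 1) := by
    intro r hr
    have h1 := hsol.norm_momentum_sub_le (t := t)
      (B := fun r => D / (ρ * lam) * (1 + lam * |t| * r) ^ ρ)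
      (B' := fun r => |t| * (D * (1 + lam * |t| * r) ^ (ρ - 1))) (by positivity)
      (fun r hr => by
        have hr0 := hr.1
        have h2 : HasDerivAt (fun r => 1 + lam * |t| * r) (lam * |t|) r := by
          simpa using ((hasDerivAt_id r).const_mul (lam * |t|)).const_add 1
        refine ((h2.rpow_const (p := ρ) (Or.inl (by positivity))).const_mul
          (D / (ρ * lam))).congr_deriv ?_
        field_simp)
      (fun r hr => mul_le_mul_of_nonneg_left (hforce r hr) (abs_nonneg t)) r hr
    rw [hΞt] at h1
    have hr0 := hr.1
    calc _ ≤ D / (ρ * lam) * (1 + lam * |t| * r) ^ ρ := h1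
      _ ≤ D / (ρ * lam) * (lam * (1 + |t|)) ^ ρ := by
        gcongr
        nlinarith [mul_le_of_le_one_right (by positivity : 0 ≤ lam * |t|) hr.2]
      _ = F * lam ^ (ρ - 1) := by
        rw [Real.mul_rpow hlam0.le (by positivity), Real.rpow_sub_one hlam0.ne', hF]
        field_simp
  have hmem : (1 : ℝ) ∈ Set.Icc (0 : ℝ) 1 := Set.right_mem_Icc.2 zero_le_one
  have hΞ := hsharp 1 hmem
  have hX := hsol.norm_position_sub_le (by positivity) hsharp 1 hmem
  rw [one_mul, sub_self] at hΞ hX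
  rw [hXt, smul_smul, mul_comm t lam] at hX
  have hG : 0 ≤ F * lam ^ (ρ - 1) := by positivity
  have htG := mul_nonneg (abs_nonneg t) hG
  constructor <;> linarith

end
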